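/- For any integers N, D ≥ 1, r₃(N) ≫ √D · N · 2^(−D) · N^(−2/D), where r₃(N) is the maximum size of a subset of {1,…,N} containing no non-trivial 3-term arithmetic progression, and ≫ hides an absolute constant. -/

import Mathlib

theorem second_moment (h : ℕ) (g : Fin h → ℝ) (v : ℝ) (h0 : ∑ k, g k = 0)
    (h1 : ∑ k, g k ^ 2 = h * v) (D : ℕ) : ∀ t : ℝ,
    ∑ x : Fin D → Fin h, (t + ∑ i, g (x i)) ^ 2 = (h : ℝ) ^ D * (t ^ 2 + D * v) := by
  induction D with
  | zero => intro t; simp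
  | succ D ih =>
    intro t
    rw [← (Fin.consEquiv (fun _ : Fin (D + 1) => Fin h)).sum_comp, Fintype.sum_prod_type]
    have : ∀ k : Fin h, ∑ y : Fin D → Fin h,
        (t + ∑ i, g ((Fin.consEquiv (fun _ : Fin (D + 1) => Fin h)) (k, y) i)) ^ 2
        = (h : ℝ) ^ D * ((t + g k) ^ 2 + D * v) := by
      intro k
      rw [← ih (t + g k)]
      refine Finset.sum_congr rfl fun y _ => ?_
      simp [Fin.consEquiv, Fin.sum_univ_succ, add_assoc]
    simp_rw [this]
    rw [← Finset.mul_sum]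
    have h2 : ∑ k, ((t + g k) ^ 2 + D * v) = h * t ^ 2 + 2 * t * ∑ k, g k + ∑ k, g k ^ 2 + h * (D * v) := by
      simp only [add_sq, Finset.sum_add_distrib, Finset.mul_sum]
      simp
    rw [h2, h0, h1]
    push_cast
    ring

theorem geom_one (r : ℝ) (h0 : 0 ≤ r) (h1 : r < 1) (n : ℕ) :
    ∑ k ∈ Finset.range n, r ^ k ≤ 1 / (1 - r) := by
  rw [one_div, ← tsum_geometric_of_lt_one h0 h1]
  exact (summable_geometric_of_lt_one h0 h1).sum_le_tsum _ (fun i _ => by positivity)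

theorem geom_two (r : ℝ) (h0 : 0 ≤ r) (h1 : r < 1) (h y : ℕ) :
    ∑ k ∈ Finset.range h, r ^ (((k : ℤ) - y).natAbs) ≤ 2 / (1 - r) := by
  calc ∑ k ∈ Finset.range h, r ^ (((k : ℤ) - y).natAbs)
      ≤ ∑ k ∈ Finset.range ((y + 1) + h), r ^ (((k : ℤ) - y).natAbs) := by
        apply Finset.sum_le_sum_of_subset_of_nonneg
        · intro k; simp; omega
        · intros; positivity
    _ = ∑ k ∈ Finset.range (y + 1), r ^ k + ∑ k ∈ Finset.range h, r ^ (k + 1) := by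
        rw [Finset.sum_range_add]
        congr 1
        · rw [← Finset.sum_range_reflect]
          refine Finset.sum_congr rfl fun k hk => ?_
          rw [Finset.mem_range] at hk
          congr 1
          omega
        · refine Finset.sum_congr rfl fun k hk => ?_
          congr 1
          omega
    _ ≤ ∑ k ∈ Finset.range (y + 1), r ^ k + ∑ k ∈ Finset.range h, r ^ k := by
        gcongr 2 with k hk
        exact pow_le_pow_of_le_one h0 h1.le (by omega)
    _ ≤ 1 / (1 - r) + 1 / (1 - r) := add_le_add (geom_one r h0 h1 _) (geom_one r h0 h1 _)
    _ = 2 / (1 - r) := by ring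

theorem count_near (D h w : ℕ) (hD : 1 ≤ D) (hw : D ≤ w) (y : Fin D → Fin h) :
    ((Finset.univ.filter fun x : Fin D → Fin h =>
      ∑ i, (((x i : ℕ) : ℤ) - ((y i : ℕ) : ℤ)) ^ 2 < w).card : ℝ) ≤
      (12 * Real.sqrt (w / D)) ^ D := by
  have hD' : (0 : ℝ) < D := by exact_mod_cast hD
  have hwD : (D : ℝ) ≤ w := by exact_mod_cast hw
  have hw' : (0 : ℝ) < w := by linarith
  set q := Real.sqrt (w / D) with hq
  have hqs : q ^ 2 = w / D := Real.sq_sqrt (by positivity)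
  have hq1 : 1 ≤ q := by
    rw [hq, Real.one_le_sqrt, one_le_div hD']; exact hwD
  set s := 1 / q with hs
  have hs0 : 0 < s := by positivity
  have hs1 : s ≤ 1 := by rw [hs, div_le_one (by positivity)]; exact hq1
  set r := Real.exp (-s) with hr
  have hr1 : r < 1 := by rw [hr, Real.exp_lt_one_iff]; linarith
  have hr2 : s / 2 ≤ 1 - r := by
    have : Real.exp (-s) ≤ 1 / (1 + s) := by
      rw [Real.exp_neg, one_div]
      gcongr
      linarith [Real.add_one_le_exp s]
    have h2 : 1 / (1 + s) ≤ 1 - s / 2 := by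
      rw [div_le_iff₀ (by positivity)]; nlinarith
    linarith
  calc ((Finset.univ.filter fun x : Fin D → Fin h =>
      ∑ i, (((x i : ℕ) : ℤ) - ((y i : ℕ) : ℤ)) ^ 2 < w).card : ℝ)
      = ∑ x ∈ (Finset.univ.filter fun x : Fin D → Fin h =>
      ∑ i, (((x i : ℕ) : ℤ) - ((y i : ℕ) : ℤ)) ^ 2 < w), (1 : ℝ) := by simp
    _ ≤ ∑ x ∈ (Finset.univ.filter fun x : Fin D → Fin h =>
      ∑ i, (((x i : ℕ) : ℤ) - ((y i : ℕ) : ℤ)) ^ 2 < w),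
        Real.exp D * ∏ i, r ^ ((((x i : ℕ) : ℤ) - ((y i : ℕ) : ℤ)).natAbs) := by
        refine Finset.sum_le_sum fun x hx => ?_
        rw [Finset.mem_filter] at hx
        have hx := hx.2
        rw [Finset.prod_pow_eq_pow_sum, hr, ← Real.exp_nat_mul, ← Real.exp_add]
        apply Real.one_le_exp
        set L := ∑ i, ((((x i : ℕ) : ℤ) - ((y i : ℕ) : ℤ)).natAbs) with hL
        have hcs : (L : ℝ) ^ 2 ≤ D * w := by
          have h1 : (∑ i, (((((x i : ℕ) : ℤ) - ((y i : ℕ) : ℤ)).natAbs : ℕ) : ℝ)) ^ 2 ≤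
            (Finset.univ : Finset (Fin D)).card * ∑ i, (((((x i : ℕ) : ℤ) - ((y i : ℕ) : ℤ)).natAbs : ℕ) : ℝ) ^ 2 :=
            sq_sum_le_card_mul_sum_sq
          have h2 : ∑ i, (((((x i : ℕ) : ℤ) - ((y i : ℕ) : ℤ)).natAbs : ℕ) : ℝ) ^ 2 ≤ w := by
            have h3 : (((∑ i, (((x i : ℕ) : ℤ) - ((y i : ℕ) : ℤ)) ^ 2 : ℤ)) : ℝ) ≤ ((w : ℤ) : ℝ) := by
              exact_mod_cast hx.le
            refine le_trans (le_of_eq ?_) (h3.trans (le_of_eq (by simp)))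
            push_cast
            refine Finset.sum_congr rfl fun i _ => ?_
            rw [Nat.cast_natAbs]
            push_cast
            rw [sq_abs]
          rw [hL]
          push_cast only [Nat.cast_sum]
          refine h1.trans ?_
          simp only [Finset.card_univ, Fintype.card_fin]
          gcongr
        have hLq : (L : ℝ) ≤ D * q := by
          apply le_of_sq_le_sq _ (by positivity)
          rw [mul_pow, hqs]
          refine hcs.trans (le_of_eq ?_)
          field_simp
        have : (L : ℝ) * s ≤ D := by
          rw [hs, mul_one_div, div_le_iff₀ (by positivity)]; exact hLq
        linarith
    _ ≤ ∑ x : Fin D → Fin h,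
        Real.exp D * ∏ i, r ^ ((((x i : ℕ) : ℤ) - ((y i : ℕ) : ℤ)).natAbs) := by
        apply Finset.sum_le_sum_of_subset_of_nonneg (Finset.filter_subset _ _)
        intros; positivity
    _ = Real.exp D * ∏ i, ∑ k : Fin h, r ^ ((((k : ℕ) : ℤ) - ((y i : ℕ) : ℤ)).natAbs) := by
        rw [← Finset.mul_sum, Finset.prod_univ_sum, Fintype.piFinset_univ]
    _ ≤ Real.exp D * ∏ i : Fin D, (4 * q) := by
        gcongr with i
        rw [Fin.sum_univ_eq_sum_range (fun k => r ^ (((k : ℤ) - ((y i : ℕ) : ℤ)).natAbs))]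
        refine (geom_two r (Real.exp_nonneg _) hr1 h (y i)).trans ?_
        rw [div_le_iff₀ (by linarith)]
        have : q * s = 1 := by rw [hs]; field_simp
        nlinarith
    _ ≤ (12 * q) ^ D := by
        rw [Finset.prod_const, Finset.card_univ, Fintype.card_fin]
        have : Real.exp D = Real.exp 1 ^ D := by rw [← Real.exp_nat_mul]; simp
        rw [this, ← mul_pow]
        have := Real.exp_one_lt_d9
        have h9 : Real.exp 1 * (4 * q) ≤ 12 * q := by nlinarith
        exact pow_le_pow_left₀ (by positivity) h9 D

theorem random_group (p N D : ℕ) [Fact p.Prime] (hN : N < p) (S : Finset (Fin D → ZMod p))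
    (K : ℝ)
    (hP : (((S ×ˢ S).filter fun q => 2 • q.2 - q.1 ∈ S).card : ℝ) ≤ S.card * K)
    (hK : 2 * N * K ≤ (p : ℝ) ^ D) :
    ∃ A : Finset ℕ, A ⊆ Finset.Icc 1 N ∧
        (∀ x ∈ A, ∀ y ∈ A, ∀ z ∈ A, x + z = 2 * y → x = z) ∧
        (N * S.card : ℝ) ≤ 2 * (p : ℝ) ^ D * A.card := by
  classical
  let V := Fin D → ZMod p
  have hV : Fintype.card V = p ^ D := by simp [V, ZMod.card]
  set P := ((S ×ˢ S).filter fun q => 2 • q.2 - q.1 ∈ S) with hPdef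
  let f : V × V → ℕ → V := fun ω n => (n : ZMod p) • ω.1 + ω.2
  let I := Finset.Icc 1 N
  let A : V × V → Finset ℕ := fun ω => I.filter fun n => f ω n ∈ S
  let T : V × V → Finset (ℕ × ℕ) := fun ω =>
    (I ×ˢ I).filter fun q => q.1 ≠ q.2 ∧ (f ω q.1, f ω q.2) ∈ P
  have hA : ∑ ω, ((A ω).card : ℝ) = N * (p ^ D * S.card) := by
    have h1 : ∀ ω, ((A ω).card : ℝ) = ∑ n ∈ I, if f ω n ∈ S then (1 : ℝ) else 0 := by
      intro ω; simp [A]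
    simp_rw [h1]
    rw [Finset.sum_comm]
    have h2 : ∀ n ∈ I, ∑ ω : V × V, (if f ω n ∈ S then (1 : ℝ) else 0) = p ^ D * S.card := by
      intro n _
      rw [Fintype.sum_prod_type]
      have h3 : ∀ θ : V, ∑ α : V, (if f (θ, α) n ∈ S then (1 : ℝ) else 0) = S.card := by
        intro θ
        have := Equiv.sum_comp (Equiv.addLeft ((n : ZMod p) • θ)) (fun β : V => if β ∈ S then (1 : ℝ) else 0)
        simp only [Equiv.coe_addLeft] at this
        simp only [f]
        refine Eq.trans ?_ (this.trans ?_)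
        · rfl
        · simp
      simp_rw [h3]
      simp [hV]
    rw [Finset.sum_congr rfl h2]
    simp [I]
  have hT : ∑ ω, ((T ω).card : ℝ) ≤ N * N * (S.card * K) := by
    have h1 : ∀ ω, ((T ω).card : ℝ) = ∑ q ∈ I ×ˢ I,
        if q.1 ≠ q.2 ∧ (f ω q.1, f ω q.2) ∈ P then (1 : ℝ) else 0 := by
      intro ω; simp only [T]; rw [Finset.sum_boole]
    simp_rw [h1]
    rw [Finset.sum_comm]
    have h2 : ∀ q ∈ I ×ˢ I, ∑ ω : V × V,
        (if q.1 ≠ q.2 ∧ (f ω q.1, f ω q.2) ∈ P then (1 : ℝ) else 0) ≤ S.card * K := by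
      intro q hq
      rw [Finset.sum_boole]
      refine le_trans ?_ hP
      rw [Nat.cast_le]
      by_cases hne : q.1 = q.2
      · simp [hne]
      apply Finset.card_le_card_of_injOn (fun ω => (f ω q.1, f ω q.2))
      · intro ω hω
        simp only [Finset.coe_filter, Set.mem_ofPred_eq] at hω
        exact hω.2.2
      · rintro ⟨θ, α⟩ _ ⟨θ', α'⟩ _ heq
        simp only [Prod.mk.injEq, f] at heq
        obtain ⟨e1, e2⟩ := heq
        simp only [I, Finset.mem_product, Finset.mem_Icc] at hq
        have hc : ((q.1 : ZMod p) - q.2) ≠ 0 := by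
          rw [sub_ne_zero]
          intro hc
          rw [ZMod.natCast_eq_natCast_iff] at hc
          exact hne (hc.eq_of_lt_of_lt (by omega) (by omega))
        have e3 : ((q.1 : ZMod p) - q.2) • θ = ((q.1 : ZMod p) - q.2) • θ' := by
          rw [sub_smul, sub_smul]
          have := congrArg₂ (· - ·) e1 e2
          simpa using this
        have e4 : θ = θ' := smul_right_injective _ hc e3
        subst e4
        simpa using e1
    refine (Finset.sum_le_card_nsmul _ _ _ h2).trans (le_of_eq ?_)
    simp [I]
  have hex : ∃ ω : V × V, (N * S.card : ℝ) ≤ 2 * (p : ℝ) ^ D * ((A ω).card - (T ω).card) := by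
    by_contra! hcon
    have hlt := Finset.sum_lt_sum_of_nonempty (s := (Finset.univ : Finset (V × V))) Finset.univ_nonempty
      (fun ω _ => hcon ω)
    rw [← Finset.mul_sum, Finset.sum_sub_distrib, hA] at hlt
    simp only [Finset.sum_const, Finset.card_univ, Fintype.card_prod, hV, nsmul_eq_mul] at hlt
    push_cast at hlt
    have hp : (0 : ℝ) < (p : ℝ) ^ D := by
      have := (Fact.out : p.Prime).pos
      positivity
    have h5 : N * N * (S.card * K) * 2 ≤ N * S.card * (p : ℝ) ^ D := by
      calc N * N * (S.card * K) * 2 = N * S.card * (2 * N * K) := by ring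
        _ ≤ _ := by gcongr
    have h6 : (p:ℝ) ^ D * (2 * (N * ((p:ℝ) ^ D * S.card) - ∑ ω, ((T ω).card : ℝ))) < (p:ℝ) ^ D * ((p:ℝ) ^ D * (N * S.card)) := by
      nlinarith
    have h7 := lt_of_mul_lt_mul_left h6 hp.le
    nlinarith
  obtain ⟨ω, hω⟩ := hex
  refine ⟨A ω \ (T ω).image Prod.fst, ?_, ?_, ?_⟩
  · exact Finset.sdiff_subset.trans (Finset.filter_subset _ _)
  · intro x hx y hy z hz hxyz
    by_contra hne
    rw [Finset.mem_sdiff] at hx hy hz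
    apply hx.2
    rw [Finset.mem_image]
    refine ⟨(x, y), ?_, rfl⟩
    have hx1 := Finset.mem_filter.1 hx.1
    have hy1 := Finset.mem_filter.1 hy.1
    have hz1 := Finset.mem_filter.1 hz.1
    refine Finset.mem_filter.2 ⟨Finset.mk_mem_product hx1.1 hy1.1, by simp only; omega, ?_⟩
    refine Finset.mem_filter.2 ⟨Finset.mk_mem_product hx1.2 hy1.2, ?_⟩
    have : 2 • f ω y - f ω x = f ω z := by
      have hc : (x : ZMod p) + z = 2 * y := by exact_mod_cast congrArg (Nat.cast : ℕ → ZMod p) hxyz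
      have hz : (z : ZMod p) = 2 * y - x := by rw [← hc]; ring
      simp only [f, hz]
      module
    simp only [this]
    exact hz1.2
  · refine hω.trans ?_
    gcongr
    have h1 := Finset.le_card_sdiff ((T ω).image Prod.fst) (A ω)
    have h2 : ((T ω).image Prod.fst).card ≤ (T ω).card := Finset.card_image_le
    rw [sub_le_iff_le_add]
    norm_cast
    omega

theorem random_box (p N D h : ℕ) [Fact p.Prime] (hN : N < p) (hh : 2 * h ≤ p + 1)
    (S : Finset (Fin D → Fin h)) (K : ℝ)
    (hP : ∀ y ∈ S, ((S.filter fun x => ∃ z ∈ S, ∀ i, (x i : ℕ) + z i = 2 * y i).card : ℝ) ≤ K)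
    (hK : 2 * N * K ≤ (p : ℝ) ^ D) :
    ∃ A : Finset ℕ, A ⊆ Finset.Icc 1 N ∧
        (∀ x ∈ A, ∀ y ∈ A, ∀ z ∈ A, x + z = 2 * y → x = z) ∧
        (N * S.card : ℝ) ≤ 2 * (p : ℝ) ^ D * A.card := by
  classical
  let e : (Fin D → Fin h) → (Fin D → ZMod p) := fun x i => ((x i : ℕ) : ZMod p)
  have key : ∀ a b : ℕ, a < p → b < p → (a : ZMod p) = b → a = b := by
    intro a b ha hb hab
    rw [ZMod.natCast_eq_natCast_iff] at hab
    exact hab.eq_of_lt_of_lt ha hb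
  have hp2 := (Fact.out : p.Prime).two_le
  have he : Function.Injective e := by
    intro x y hxy
    ext i
    have := congrFun hxy i
    exact key _ _ (by have := (x i).2; omega) (by have := (y i).2; omega) this
  have hcard : (S.image e).card = S.card := Finset.card_image_of_injective _ he
  have := random_group p N D hN (S.image e) K ?_ hK
  · rwa [hcard] at this
  rw [hcard]
  have hsub : (((S.image e) ×ˢ (S.image e)).filter fun q => 2 • q.2 - q.1 ∈ S.image e) ⊆
      (S.sigma (fun y => S.filter fun x => ∃ z ∈ S, ∀ i, (x i : ℕ) + z i = 2 * y i)).image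
        (fun q => (e q.2, e q.1)) := by
    intro q hq
    rw [Finset.mem_filter, Finset.mem_product, Finset.mem_image, Finset.mem_image, Finset.mem_image] at hq
    obtain ⟨⟨⟨x, hx, hx'⟩, ⟨y, hy, hy'⟩⟩, ⟨z, hz, hz'⟩⟩ := hq
    rw [Finset.mem_image]
    refine ⟨⟨y, x⟩, ?_, by simp [hx', hy']⟩
    rw [Finset.mem_sigma, Finset.mem_filter]
    refine ⟨hy, hx, z, hz, fun i => ?_⟩
    have h1 := (x i).2
    have h2 := (y i).2
    have h3 := (z i).2
    apply key _ _ (by omega) (by omega)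
    have := congrFun hz' i
    rw [← hx', ← hy'] at this
    simp only [e, Pi.sub_apply, Pi.smul_apply] at this
    rw [nsmul_eq_mul] at this
    push_cast at this ⊢
    rw [this]; ring
  calc _ ≤ (((S.sigma (fun y => S.filter fun x => ∃ z ∈ S, ∀ i, (x i : ℕ) + z i = 2 * y i)).card : ℕ) : ℝ) := by
        exact_mod_cast (Finset.card_le_card hsub).trans Finset.card_image_le
    _ ≤ S.card * K := by
        rw [Finset.card_sigma]
        push_cast
        refine (Finset.sum_le_card_nsmul _ _ _ hP).trans (le_of_eq ?_)
        simp
theorem annulus (D h w : ℕ) (hD : 1 ≤ D) (hh : 1 ≤ h) (hw : 1 ≤ w) : ∃ J : ℤ,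
    (h : ℝ) ^ D / 2 * w ≤ (4 * Real.sqrt D * h ^ 2 + 2 * w) *
      ((Finset.univ.filter fun x : Fin D → Fin h =>
        ⌊((∑ i, (x i : ℕ) ^ 2 : ℕ) : ℝ) / w⌋ = J).card : ℝ) := by
  classical
  have hD' : (0 : ℝ) < D := by exact_mod_cast hD
  have hh' : (0 : ℝ) < h := by exact_mod_cast hh
  have hw' : (0 : ℝ) < w := by exact_mod_cast hw
  set m : ℝ := (∑ k : Fin h, ((k : ℕ) : ℝ) ^ 2) / h with hm
  let g : Fin h → ℝ := fun k => ((k : ℕ) : ℝ) ^ 2 - m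
  have hk : ∀ k : Fin h, ((k : ℕ) : ℝ) ^ 2 ≤ (h : ℝ) ^ 2 := by
    intro k
    have : ((k : ℕ) : ℝ) ≤ h := by exact_mod_cast k.2.le
    gcongr
  have hm0 : 0 ≤ m := by positivity
  have hm1 : m ≤ (h : ℝ) ^ 2 := by
    rw [hm, div_le_iff₀ hh']
    refine (Finset.sum_le_card_nsmul _ _ _ (fun k _ => hk k)).trans (le_of_eq ?_)
    simp [mul_comm]
  have hg0 : ∑ k, g k = 0 := by
    simp only [g, Finset.sum_sub_distrib]
    simp [hm]
    field_simp
    simp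
  set v : ℝ := (∑ k, g k ^ 2) / h with hv
  have hg1 : ∑ k, g k ^ 2 = h * v := by rw [hv]; field_simp
  have hv1 : v ≤ (h : ℝ) ^ 4 := by
    rw [hv, div_le_iff₀ hh']
    have : ∀ k ∈ (Finset.univ : Finset (Fin h)), g k ^ 2 ≤ (h : ℝ) ^ 4 := by
      intro k _
      have h1 := hk k
      have h2 : 0 ≤ ((k : ℕ) : ℝ) ^ 2 := by positivity
      have h3 : |g k| ≤ (h : ℝ) ^ 2 := by
        simp only [g]; rw [abs_le]; constructor <;> linarith
      calc g k ^ 2 = |g k| ^ 2 := (sq_abs _).symm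
        _ ≤ ((h : ℝ) ^ 2) ^ 2 := by gcongr
        _ = _ := by ring
    refine (Finset.sum_le_card_nsmul _ _ _ this).trans (le_of_eq ?_)
    simp [mul_comm]
  have hsm := second_moment h g v hg0 hg1 D 0
  let X : (Fin D → Fin h) → ℝ := fun x => ((∑ i, (x i : ℕ) ^ 2 : ℕ) : ℝ)
  have hX : ∀ x : Fin D → Fin h, 0 + ∑ i, g (x i) = X x - D * m := by
    intro x
    simp [g, X, Finset.sum_sub_distrib]
  simp_rw [hX] at hsm
  set Λ : ℝ := 2 * Real.sqrt D * h ^ 2 with hΛ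
  have hΛ0 : 0 < Λ := by positivity
  have hΛ2 : Λ ^ 2 = 4 * D * h ^ 4 := by
    rw [hΛ, mul_pow, mul_pow, Real.sq_sqrt hD'.le]; ring
  set G := Finset.univ.filter fun x => |X x - D * m| ≤ Λ with hG
  set Gc := Finset.univ.filter fun x => ¬ |X x - D * m| ≤ Λ with hGc
  have hcard : (G.card : ℝ) + Gc.card = (h : ℝ) ^ D := by
    have := Finset.card_filter_add_card_filter_not (s := (Finset.univ : Finset (Fin D → Fin h))) (fun x => |X x - D * m| ≤ Λ)
    rw [Finset.card_univ, Fintype.card_fun, Fintype.card_fin, Fintype.card_fin] at this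
    exact_mod_cast this
  have hbad : (Gc.card : ℝ) * Λ ^ 2 ≤ (h : ℝ) ^ D * (D * h ^ 4) := by
    calc (Gc.card : ℝ) * Λ ^ 2 = ∑ x ∈ Gc, Λ ^ 2 := by simp
      _ ≤ ∑ x ∈ Gc, (X x - D * m) ^ 2 := by
        refine Finset.sum_le_sum fun x hx => ?_
        have := (Finset.mem_filter.1 hx).2
        rw [← sq_abs (X x - D * m)]
        push Not at this
        gcongr
      _ ≤ ∑ x, (X x - D * m) ^ 2 := by
        apply Finset.sum_le_sum_of_subset_of_nonneg (Finset.filter_subset _ _)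
        intros; positivity
      _ = (h : ℝ) ^ D * (0 ^ 2 + D * v) := hsm
      _ ≤ _ := by
        gcongr
        nlinarith
  have hGc : (Gc.card : ℝ) ≤ (h : ℝ) ^ D / 4 := by
    rw [hΛ2] at hbad
    have hpos : (0 : ℝ) < 4 * D * h ^ 4 := by positivity
    refine le_of_mul_le_mul_right (hbad.trans (le_of_eq ?_)) hpos
    ring
  have hGcard : (h : ℝ) ^ D / 2 ≤ G.card := by
    have : (0 : ℝ) < (h : ℝ) ^ D := by positivity
    linarith
  let t : Finset ℤ := Finset.Icc ⌊(D * m - Λ) / w⌋ ⌊(D * m + Λ) / w⌋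
  have hab : ⌊(D * m - Λ) / w⌋ ≤ ⌊(D * m + Λ) / w⌋ := by
    apply Int.floor_mono; gcongr; linarith
  have htne : t.Nonempty := Finset.nonempty_Icc.2 hab
  have htc : (t.card : ℝ) * w ≤ 4 * Real.sqrt D * h ^ 2 + 2 * w := by
    have h1 : ((t.card : ℤ) : ℝ) = (⌊(D * m + Λ) / w⌋ : ℝ) + 1 - ⌊(D * m - Λ) / w⌋ := by
      rw [Int.card_Icc_of_le _ _ (by omega)]
      push_cast; ring
    have h2 := Int.floor_le ((D * m + Λ) / w)
    have h3 := (Int.lt_floor_add_one ((D * m - Λ) / w)).le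
    have h4 : (t.card : ℝ) ≤ (D * m + Λ) / w - (D * m - Λ) / w + 2 := by
      have : (t.card : ℝ) = ((t.card : ℤ) : ℝ) := by simp
      rw [this, h1]; linarith
    calc (t.card : ℝ) * w ≤ ((D * m + Λ) / w - (D * m - Λ) / w + 2) * w := by gcongr
      _ = 2 * Λ + 2 * w := by field_simp; ring
      _ = _ := by rw [hΛ]; ring
  have htpos : (0 : ℝ) < t.card := by exact_mod_cast htne.card_pos
  obtain ⟨J, -, hJ⟩ := Finset.exists_le_card_fiber_of_nsmul_le_card_of_maps_to
    (s := G) (t := t) (f := fun x => ⌊X x / w⌋) (b := (G.card : ℝ) / t.card) (by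
      intro x hx
      have := abs_le.1 (Finset.mem_filter.1 hx).2
      rw [Finset.mem_Icc]
      constructor
      · apply Int.floor_mono; gcongr; linarith
      · apply Int.floor_mono; gcongr; linarith) htne (by
      rw [nsmul_eq_mul]; exact (mul_div_cancel₀ _ htpos.ne').le)
  refine ⟨J, ?_⟩
  set F := (Finset.univ.filter fun x : Fin D → Fin h =>
        ⌊((∑ i, (x i : ℕ) ^ 2 : ℕ) : ℝ) / w⌋ = J) with hF
  have hFc : (G.card : ℝ) / t.card ≤ F.card := by
    refine hJ.trans ?_
    rw [Nat.cast_le]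
    apply Finset.card_le_card
    exact Finset.filter_subset_filter _ (Finset.subset_univ _)
  rw [div_le_iff₀ htpos] at hFc
  calc (h : ℝ) ^ D / 2 * w ≤ (F.card * t.card) * w := 
        mul_le_mul_of_nonneg_right (hGcard.trans hFc) hw'.le
    _ = (t.card * w) * F.card := by ring
    _ ≤ _ := mul_le_mul_of_nonneg_right htc (Nat.cast_nonneg _)

theorem behrend_min (N D : ℕ) (hN : 1 ≤ N) (hD : 1 ≤ D) :
    ∃ A : Finset ℕ, A ⊆ Finset.Icc 1 N ∧
        (∀ x ∈ A, ∀ y ∈ A, ∀ z ∈ A, x + z = 2 * y → x = z) ∧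
        (1 / 30000) * N * (1 / 2 ^ D) *
          min 1 (Real.sqrt D * (N:ℝ) ^ (-(2:ℝ)/(D:ℝ))) ≤ A.card := by
  classical
  have hD' : (1 : ℝ) ≤ D := by exact_mod_cast hD
  have hD0 : (0 : ℝ) < D := by linarith
  have hN' : (1 : ℝ) ≤ N := by exact_mod_cast hN
  have hN0 : (0 : ℝ) < N := by linarith
  set u : ℝ := (N : ℝ) ^ (-(1 : ℝ) / D) with hu
  have hu0 : 0 < u := by positivity
  have huD : u ^ D = 1 / N := by
    rw [hu, ← Real.rpow_natCast, ← Real.rpow_mul hN0.le, div_mul_cancel₀ _ hD0.ne', Real.rpow_neg_one, one_div]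
  have hu2 : (N:ℝ) ^ (-(2:ℝ)/(D:ℝ)) = u ^ 2 := by
    rw [hu, ← Real.rpow_natCast, ← Real.rpow_mul hN0.le]
    congr 1
    push_cast
    ring
  rw [hu2]
  set σ := Real.sqrt D with hσ
  have hσ2 : σ ^ 2 = D := Real.sq_sqrt hD0.le
  have hσ1 : 1 ≤ σ := by rw [hσ, Real.one_le_sqrt]; exact hD'
  set τ := min 1 (σ * u ^ 2) with hτ
  have hτ0 : 0 < τ := by rw [hτ]; positivity
  have hτ1 : τ ≤ 1 := min_le_left _ _
  have hτ2 : τ ≤ σ * u ^ 2 := min_le_right _ _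
  obtain ⟨p, hpge, hpp⟩ := Nat.exists_infinite_primes (N + 1 + ⌈1152 * D / τ⌉₊)
  haveI : Fact p.Prime := ⟨hpp⟩
  have hp1 : 1152 * D / τ ≤ (p : ℝ) := by
    refine (Nat.le_ceil _).trans ?_
    exact_mod_cast (by omega : ⌈1152 * D / τ⌉₊ ≤ p)
  have hp2 : (2 : ℝ) ≤ p := by exact_mod_cast hpp.two_le
  have hp0 : (0 : ℝ) < p := by linarith
  set Y : ℝ := σ * p ^ 2 * τ / 576 with hY
  have hY1 : 2 * (D : ℝ) ≤ Y := by
    rw [div_le_iff₀ hτ0] at hp1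
    have h1 : (p : ℝ) * τ ≤ σ * p ^ 2 * τ := by
      have : (p : ℝ) ≤ σ * p ^ 2 := by nlinarith
      gcongr
    rw [hY]; linarith
  set w := ⌊Y⌋₊ with hw
  have hwY : (w : ℝ) ≤ Y := Nat.floor_le (by positivity)
  have hwY2 : Y / 2 ≤ w := by
    have := Nat.lt_floor_add_one Y
    linarith
  have hwD : D ≤ w := Nat.le_floor (by linarith)
  set h := (p + 1) / 2 with hh
  have hh1 : 2 * h ≤ p + 1 := by omega
  have hh2 : (p : ℝ) / 2 ≤ h := by
    have : p ≤ 2 * h := by omega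
    have : (p : ℝ) ≤ 2 * h := by exact_mod_cast this
    linarith
  have hh3 : (h : ℝ) ≤ p := by
    have := hpp.two_le
    exact_mod_cast (by omega : h ≤ p)
  have hh0 : 1 ≤ h := by have := hpp.two_le; omega
  obtain ⟨J, hJ⟩ := annulus D h w hD hh0 (by omega)
  set S := (Finset.univ.filter fun x : Fin D → Fin h =>
        ⌊((∑ i, (x i : ℕ) ^ 2 : ℕ) : ℝ) / w⌋ = J) with hS
  have hw0 : (0 : ℝ) < w := by exact_mod_cast (by omega : 0 < w)
  have hK : 2 * N * (12 * Real.sqrt (w / D)) ^ D ≤ (p : ℝ) ^ D := by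
    have h1 : Real.sqrt (w / D) ≤ p * u / 24 := by
      apply Real.sqrt_le_iff.2 ⟨by positivity, ?_⟩
      rw [div_le_iff₀ hD0]
      refine hwY.trans ?_
      rw [hY]
      calc σ * p ^ 2 * τ / 576 ≤ σ * p ^ 2 * (σ * u ^ 2) / 576 := by gcongr
        _ = σ ^ 2 * p ^ 2 * u ^ 2 / 576 := by ring
        _ = _ := by rw [hσ2]; ring
    calc 2 * N * (12 * Real.sqrt (w / D)) ^ D ≤ 2 * N * (12 * (p * u / 24)) ^ D := by gcongr
      _ = 2 * N * (p ^ D * u ^ D * (1 / 2) ^ D) := by rw [← mul_pow, ← mul_pow]; ring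
      _ = 2 * (1 / 2) ^ D * p ^ D := by rw [huD]; field_simp
      _ ≤ 1 * p ^ D := by
        gcongr
        have : (1 / 2 : ℝ) ^ D ≤ (1 / 2) ^ 1 := pow_le_pow_of_le_one (by norm_num) (by norm_num) hD
        linarith
      _ = _ := one_mul _
  obtain ⟨A, hA1, hA2, hA3⟩ := random_box p N D h (by omega) hh1 S _ (by
    intro y hy
    refine le_trans ?_ (count_near D h w hD hwD y)
    rw [Nat.cast_le]
    apply Finset.card_le_card
    intro x hx
    rw [Finset.mem_filter] at hx ⊢
    refine ⟨Finset.mem_univ _, ?_⟩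
    obtain ⟨hxS, z, hzS, hz⟩ := hx
    have fx := Int.floor_eq_iff.1 (Finset.mem_filter.1 hxS).2
    have fy := Int.floor_eq_iff.1 (Finset.mem_filter.1 hy).2
    have fz := Int.floor_eq_iff.1 (Finset.mem_filter.1 hzS).2
    rw [le_div_iff₀ hw0, div_lt_iff₀ hw0] at fx fy fz
    have hid : (∑ i, (((x i : ℕ) : ℝ) - ((y i : ℕ) : ℝ)) ^ 2) * 2 =
        ((∑ i, (x i : ℕ) ^ 2 : ℕ) : ℝ) + ((∑ i, (z i : ℕ) ^ 2 : ℕ) : ℝ)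
          - 2 * ((∑ i, (y i : ℕ) ^ 2 : ℕ) : ℝ) := by
      push_cast
      rw [Finset.mul_sum, Finset.sum_mul, ← Finset.sum_add_distrib, ← Finset.sum_sub_distrib]
      refine Finset.sum_congr rfl fun i _ => ?_
      have : ((x i : ℕ) : ℝ) + ((z i : ℕ) : ℝ) = 2 * ((y i : ℕ) : ℝ) := by exact_mod_cast hz i
      have hz' : ((z i : ℕ) : ℝ) = 2 * ((y i : ℕ) : ℝ) - ((x i : ℕ) : ℝ) := by linarith
      rw [hz']; ring
    have hlt : (∑ i, (((x i : ℕ) : ℝ) - ((y i : ℕ) : ℝ)) ^ 2) < (w : ℝ) := by linarith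
    exact_mod_cast hlt) hK
  refine ⟨A, hA1, hA2, ?_⟩
  have hS1 : (h : ℝ) ^ D * τ ≤ 13824 * S.card := by
    have h1 : 4 * σ * (h : ℝ) ^ 2 + 2 * w ≤ 6 * σ * p ^ 2 := by
      have h2 : σ * (h : ℝ) ^ 2 ≤ σ * p ^ 2 := by gcongr
      have h3 : Y ≤ σ * p ^ 2 := by
        have : σ * p ^ 2 * τ ≤ σ * p ^ 2 * 1 := by gcongr
        have : 0 < σ * p ^ 2 := by positivity
        rw [hY]; linarith
      linarith
    have h4 : (h : ℝ) ^ D / 2 * (Y / 2) ≤ 6 * σ * p ^ 2 * S.card := by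
      calc (h : ℝ) ^ D / 2 * (Y / 2) ≤ (h : ℝ) ^ D / 2 * w := by gcongr
        _ ≤ _ := hJ
        _ ≤ _ := by gcongr
    have h5 : (0 : ℝ) < σ * p ^ 2 := by positivity
    refine le_of_mul_le_mul_left ?_ h5
    rw [hY] at h4
    linarith
  have hhp : (p : ℝ) ^ D * (1 / 2 ^ D) ≤ (h : ℝ) ^ D := by
    calc (p : ℝ) ^ D * (1 / 2 ^ D) = (p / 2) ^ D := by rw [div_pow]; ring
      _ ≤ _ := by gcongr
  have hpD : (0 : ℝ) < (p : ℝ) ^ D := by positivity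
  refine le_of_mul_le_mul_left ?_ hpD
  have h6 : (p : ℝ) ^ D * (1 / 2 ^ D) * τ ≤ 13824 * S.card :=
    (mul_le_mul_of_nonneg_right hhp hτ0.le).trans hS1
  have h7 : N * ((p : ℝ) ^ D * (1 / 2 ^ D) * τ) ≤ N * (13824 * S.card) := by gcongr
  have h8 : (0 : ℝ) ≤ (p : ℝ) ^ D * A.card := by positivity
  calc (p : ℝ) ^ D * ((1 / 30000) * N * (1 / 2 ^ D) * τ)
      = (1 / 30000) * (N * ((p : ℝ) ^ D * (1 / 2 ^ D) * τ)) := by ring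
    _ ≤ _ := by linarith

theorem behrend_parametrized :
    ∃ C : ℝ, 0 < C ∧ ∀ N D : ℕ, 1 ≤ N → 1 ≤ D →
      ∃ A : Finset ℕ, A ⊆ Finset.Icc 1 N ∧
        (∀ x ∈ A, ∀ y ∈ A, ∀ z ∈ A, x + z = 2 * y → x = z) ∧
        C * Real.sqrt D * N * 2 ^ (-(D:ℝ)) * (N:ℝ) ^ (-(2:ℝ)/(D:ℝ)) ≤ A.card := by
  refine ⟨1 / 120000, by norm_num, fun N D hN hD => ?_⟩
  have hD' : (1 : ℝ) ≤ D := by exact_mod_cast hD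
  have hD0 : (0 : ℝ) < D := by linarith
  have hN' : (1 : ℝ) ≤ N := by exact_mod_cast hN
  have hN0 : (0 : ℝ) < N := by linarith
  have h2 : (2 : ℝ) ^ (-(D:ℝ)) = 1 / 2 ^ D := by
    rw [Real.rpow_neg (by norm_num), Real.rpow_natCast, one_div]
  rw [h2]
  by_cases hc : Real.sqrt D * (N:ℝ) ^ (-(2:ℝ)/(D:ℝ)) ≤ 1
  · obtain ⟨A, hA1, hA2, hA3⟩ := behrend_min N D hN hD
    refine ⟨A, hA1, hA2, le_trans ?_ hA3⟩
    rw [min_eq_right hc]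
    have : (0 : ℝ) ≤ N * (1 / 2 ^ D) * (Real.sqrt D * (N:ℝ) ^ (-(2:ℝ)/(D:ℝ))) := by positivity
    linarith
  · push Not at hc
    set m := D / 2 with hm
    set E := D - m with hE
    have hE1 : 1 ≤ E := by omega
    have hE0 : (0 : ℝ) < E := by exact_mod_cast hE1
    have hED : D ≤ 2 * E := by omega
    have hED' : (D : ℝ) ≤ 2 * E := by exact_mod_cast hED
    obtain ⟨A, hA1, hA2, hA3⟩ := behrend_min N E hN hE1
    refine ⟨A, hA1, hA2, le_trans ?_ hA3⟩
    set σ := Real.sqrt D with hσ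
    have hσ2 : σ ^ 2 = D := Real.sq_sqrt hD0.le
    have hσ1 : 1 ≤ σ := by rw [hσ, Real.one_le_sqrt]; exact hD'
    set u : ℝ := (N:ℝ) ^ (-(2:ℝ)/(D:ℝ)) with hu
    have hu0 : 0 < u := by positivity
    have hu1 : u ≤ 1 := Real.rpow_le_one_of_one_le_of_nonpos hN' (by
      rw [neg_div]; simp only [Left.neg_nonpos_iff]; positivity)
    have hue : u ^ 2 ≤ (N:ℝ) ^ (-(2:ℝ)/(E:ℝ)) := by
      rw [hu, ← Real.rpow_natCast, ← Real.rpow_mul hN0.le]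
      apply Real.rpow_le_rpow_of_exponent_le hN'
      push_cast
      rw [div_mul_eq_mul_div, div_le_div_iff₀ hD0 hE0]
      linarith
    have hu3 : 1 / σ ≤ u := by
      rw [div_le_iff₀ (by positivity)]; linarith
    have hmin : 1 / (2 * σ) ≤ min 1 (Real.sqrt E * (N:ℝ) ^ (-(2:ℝ)/(E:ℝ))) := by
      apply le_min
      · rw [div_le_one (by positivity)]; linarith
      · have h1 : σ / 2 ≤ Real.sqrt E := by
          apply Real.le_sqrt_of_sq_le
          rw [div_pow, hσ2]; linarith
        calc 1 / (2 * σ) = σ / 2 * (1 / σ) ^ 2 := by field_simp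
          _ ≤ Real.sqrt E * u ^ 2 := by gcongr
          _ ≤ _ := by gcongr
    have hpow : (D : ℝ) * (1 / 2 ^ D) ≤ 2 * (1 / 2 ^ E) := by
      have e1 : D = E + m := by omega
      have e2 : D ≤ 2 * 2 ^ m := by
        have : m < 2 ^ m := Nat.lt_two_pow_self
        omega
      have e3 : (D : ℝ) ≤ 2 * 2 ^ m := by exact_mod_cast e2
      have e4 : (2 : ℝ) ^ D = 2 ^ E * 2 ^ m := by rw [← pow_add, ← e1]
      rw [e4, mul_one_div, mul_one_div, div_le_div_iff₀ (by positivity) (by positivity)]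
      have : (0 : ℝ) < 2 ^ E := by positivity
      nlinarith
    calc 1 / 120000 * σ * N * (1 / 2 ^ D) * u ≤ 1 / 120000 * σ * N * (1 / 2 ^ D) * 1 := by gcongr
      _ = 1 / 120000 * N * (σ ^ 2 * (1 / 2 ^ D)) * (1 / σ) := by field_simp
      _ = 1 / 120000 * N * (D * (1 / 2 ^ D)) * (1 / σ) := by rw [hσ2]
      _ ≤ 1 / 120000 * N * (2 * (1 / 2 ^ E)) * (1 / σ) := by gcongr
      _ = 1 / 30000 * N * (1 / 2 ^ E) * (1 / (2 * σ)) := by field_simp; norm_num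
      _ ≤ _ := by gcongr
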